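/- arXiv:2207.01591 — 3 statements merged into one kernel-verified Lean document; each statement's English description precedes it below -/
import Mathlib

section
/- Let α : G^k → 𝔽₂ be a multilinear form and let U ≤ G be a subspace of codimension d. Then prank(α) ≤ prank(α|_{U×⋯×U}) + k·d. -/
open Finset

/-- `β : (Fin k → V) → ZMod 2` is a multilinear form in the variables indexed by `S`:
it depends only on the coordinates in `S` and is additive (hence `𝔽₂`-linear) in each of
those coordinates. -/
def MultilinearOn {V : Type*} [AddCommGroup V] [Module (ZMod 2) V] (k : ℕ)
    (S : Finset (Fin k)) (β : (Fin k → V) → ZMod 2) : Prop :=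
  (∀ x y : Fin k → V, (∀ i ∈ S, x i = y i) → β x = β y) ∧
  (∀ i ∈ S, ∀ (x : Fin k → V) (u v : V),
    β (Function.update x i (u + v)) = β (Function.update x i u) + β (Function.update x i v))

/-- A multilinear form in all `k` variables. -/
def IsMultilinear {V : Type*} [AddCommGroup V] [Module (ZMod 2) V] (k : ℕ)
    (α : (Fin k → V) → ZMod 2) : Prop :=
  MultilinearOn k Finset.univ α

/-- `α`, a multilinear form in the variables indexed by `S`, admits a partition-rank
decomposition with `m` terms. -/
def PrankDecompOn {V : Type*} [AddCommGroup V] [Module (ZMod 2) V] (k : ℕ)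
    (S : Finset (Fin k)) (m : ℕ) (α : (Fin k → V) → ZMod 2) : Prop :=
  ∃ (I : Fin m → Finset (Fin k)) (β γ : Fin m → ((Fin k → V) → ZMod 2)),
    (∀ i, I i ⊆ S) ∧ (∀ i, I i ≠ ∅) ∧ (∀ i, I i ≠ S) ∧
    (∀ i, MultilinearOn k (I i) (β i)) ∧
    (∀ i, MultilinearOn k (S \ I i) (γ i)) ∧
    (∀ x, α x = ∑ i, β i x * γ i x)

/-- The partition rank of a multilinear form in the variables indexed by `S`. -/
noncomputable def prankOn {V : Type*} [AddCommGroup V] [Module (ZMod 2) V] (k : ℕ)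
    (S : Finset (Fin k)) (α : (Fin k → V) → ZMod 2) : ℕ :=
  sInf {m | PrankDecompOn k S m α}

/-- The partition rank of a multilinear form in `k` variables. -/
noncomputable def prank {V : Type*} [AddCommGroup V] [Module (ZMod 2) V] (k : ℕ)
    (α : (Fin k → V) → ZMod 2) : ℕ :=
  prankOn k Finset.univ α

/-- `α ∘ π`: the form `(x₁, …, x_k) ↦ α(x_{π⁻¹(1)}, …, x_{π⁻¹(k)})`. -/
def permForm {V : Type*} (k : ℕ) (π : Equiv.Perm (Fin k))
    (α : (Fin k → V) → ZMod 2) : (Fin k → V) → ZMod 2 :=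
  fun x => α (fun i => x (π.symm i))

/-- `α` is symmetric in its first `m` variables (0-indexed: coordinates `< m`). -/
def SymmetricInFirst {V : Type*} (k m : ℕ) (α : (Fin k → V) → ZMod 2) : Prop :=
  ∀ i j : Fin k, (i : ℕ) < m → (j : ℕ) < m → permForm k (Equiv.swap i j) α = α

/-- `α` is symmetric in all of its variables. -/
def SymmetricForm {V : Type*} (k : ℕ) (α : (Fin k → V) → ZMod 2) : Prop :=
  ∀ π : Equiv.Perm (Fin k), permForm k π α = α

/-- `σ` is strongly symmetric: it is symmetric, and the form
`(x, y₃, …, y_k) ↦ σ(x, x, y₃, …, y_k)` is also symmetric.  (Given the symmetry of `σ`,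
the latter is equivalent to being allowed to swap the doubled variable with the third
variable, which is how it is stated here.) -/
def StronglySymmetric {V : Type*} (k : ℕ) (σ : (Fin k → V) → ZMod 2) : Prop :=
  SymmetricForm k σ ∧
  ∀ (u v : V) (z : Fin k → V),
    σ (fun i => if (i : ℕ) = 0 ∨ (i : ℕ) = 1 then u else if (i : ℕ) = 2 then v else z i) =
    σ (fun i => if (i : ℕ) = 0 ∨ (i : ℕ) = 1 then v else if (i : ℕ) = 2 then u else z i)

section PartitionRank

variable {V W : Type*} [AddCommGroup V] [Module (ZMod 2) V] [AddCommGroup W] [Module (ZMod 2) W]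
  {k : ℕ}

lemma MultilinearOn.comp_linearMap {S : Finset (Fin k)} {β : (Fin k → W) → ZMod 2}
    (hβ : MultilinearOn k S β) (L : Fin k → V →ₗ[ZMod 2] W) :
    MultilinearOn k S (fun x => β fun i => L i (x i)) := by
  have key (i : Fin k) (x : Fin k → V) (u : V) :
      (fun j => L j (Function.update x i u j)) =
        Function.update (fun j => L j (x j)) i (L i u) := by
    ext j
    rcases eq_or_ne j i with rfl | h
    · simp
    · simp [h]
  refine ⟨fun x y h => hβ.1 _ _ fun i hi => by rw [h i hi], fun i hi x u v => ?_⟩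
  simp only [key, map_add, hβ.2 i hi]

lemma MultilinearOn.map_update_sum {S : Finset (Fin k)} {β : (Fin k → V) → ZMod 2}
    (hβ : MultilinearOn k S β) {i : Fin k} (hi : i ∈ S) (x : Fin k → V) {d : ℕ}
    (a : Fin d → ZMod 2) (v : Fin d → V) :
    β (Function.update x i (∑ j, a j • v j)) =
      ∑ j, a j * β (Function.update x i (v j)) := by
  let φ : V →+ ZMod 2 := AddMonoidHom.mk' (fun u => β (Function.update x i u)) (hβ.2 i hi x)
  change φ _ = ∑ j, a j * φ (v j)
  rw [map_sum]
  exact Finset.sum_congr rfl fun j _ => ZMod.map_smul φ (a j) (v j)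

lemma MultilinearOn.update {S : Finset (Fin k)} {β : (Fin k → V) → ZMod 2}
    (hβ : MultilinearOn k S β) (i : Fin k) (c : V) :
    MultilinearOn k (S \ {i}) (fun x => β (Function.update x i c)) := by
  refine ⟨fun x y h => hβ.1 _ _ fun j hj => ?_, fun j hj x u v => ?_⟩
  · rcases eq_or_ne j i with rfl | hji
    · simp
    · simpa [hji] using h j (by simp [hj, hji])
  · obtain ⟨hjS, hji⟩ : j ∈ S ∧ j ≠ i := by simpa using hj
    simp only [Function.update_comm hji, hβ.2 j hjS]

lemma multilinearOn_singleton (i : Fin k) (f : V →ₗ[ZMod 2] ZMod 2) :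
    MultilinearOn k {i} (fun x => f (x i)) := by
  refine ⟨fun x y h => congrArg f (h i (by simp)), fun j hj x u v => ?_⟩
  obtain rfl : j = i := by simpa using hj
  simp

lemma PrankDecompOn.zero (S : Finset (Fin k)) :
    PrankDecompOn k S 0 (fun _ : Fin k → V => 0) :=
  ⟨fun _ => ∅, fun _ _ => 0, fun _ _ => 0, by simp⟩

lemma PrankDecompOn.add {S : Finset (Fin k)} {m m' : ℕ} {α α' : (Fin k → V) → ZMod 2}
    (h : PrankDecompOn k S m α) (h' : PrankDecompOn k S m' α') :
    PrankDecompOn k S (m + m') (fun x => α x + α' x) := by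
  obtain ⟨I, β, γ, h₁, h₂, h₃, h₄, h₅, h₆⟩ := h
  obtain ⟨I', β', γ', h₁', h₂', h₃', h₄', h₅', h₆'⟩ := h'
  refine ⟨Fin.append I I', Fin.append β β', Fin.append γ γ', ?_, ?_, ?_, ?_, ?_, fun x => ?_⟩
  · exact fun i => i.addCases (by simpa using h₁) (by simpa using h₁')
  · exact fun i => i.addCases (by simpa using h₂) (by simpa using h₂')
  · exact fun i => i.addCases (by simpa using h₃) (by simpa using h₃')
  · exact fun i => i.addCases (by simpa using h₄) (by simpa using h₄')
  · exact fun i => i.addCases (by simpa using h₅) (by simpa using h₅')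
  · simp [Fin.sum_univ_add, h₆, h₆']

lemma PrankDecompOn.comp_linearMap {S : Finset (Fin k)} {m : ℕ} {α : (Fin k → W) → ZMod 2}
    (h : PrankDecompOn k S m α) (L : V →ₗ[ZMod 2] W) :
    PrankDecompOn k S m (fun x => α fun i => L (x i)) := by
  obtain ⟨I, β, γ, h₁, h₂, h₃, h₄, h₅, h₆⟩ := h
  exact ⟨I, fun i x => β i fun j => L (x j), fun i x => γ i fun j => L (x j), h₁, h₂, h₃,
    fun i => (h₄ i).comp_linearMap fun _ => L, fun i => (h₅ i).comp_linearMap fun _ => L,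
    fun x => h₆ _⟩

/-- Splitting the variable `i` along finitely many linear functionals costs one term for each
functional. -/
lemma IsMultilinear.prankDecompOn_sum (hk : 2 ≤ k) {α : (Fin k → V) → ZMod 2}
    (hα : IsMultilinear k α) (i : Fin k) {d : ℕ} (f : Fin d → V →ₗ[ZMod 2] ZMod 2)
    (c : Fin d → V) :
    PrankDecompOn k Finset.univ d
      (fun x => ∑ j, f j (x i) * α (Function.update x i (c j))) := by
  refine ⟨fun _ => {i}, fun j x => f j (x i), fun j x => α (Function.update x i (c j)),
    by simp, by simp, fun _ h => ?_, fun j => multilinearOn_singleton i (f j),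
    fun j => MultilinearOn.update hα i (c j), fun x => rfl⟩
  have := congrArg Finset.card h
  rw [Finset.card_singleton, Finset.card_fin] at this
  omega

lemma IsMultilinear.eq_update_add_sum {α : (Fin k → V) → ZMod 2} (hα : IsMultilinear k α)
    {d : ℕ} {P : V →ₗ[ZMod 2] V} {f : Fin d → V →ₗ[ZMod 2] ZMod 2} {c : Fin d → V}
    (hP : ∀ v, v = P v + ∑ j, f j v • c j) (i : Fin k) (x : Fin k → V) :
    α x = α (Function.update x i (P (x i))) +
      ∑ j, f j (x i) * α (Function.update x i (c j)) := by
  rw [← MultilinearOn.map_update_sum hα (Finset.mem_univ i), ← hα.2 i (Finset.mem_univ i),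
    ← hP, Function.update_eq_self]

/-- Composing every variable with a map `P` such that `id - P` has rank at most `d` changes a
multilinear form by at most `k * d` terms. -/
lemma IsMultilinear.prankDecompOn_of_comp (hk : 2 ≤ k) {α : (Fin k → V) → ZMod 2}
    (hα : IsMultilinear k α) {d m : ℕ} {P : V →ₗ[ZMod 2] V} {f : Fin d → V →ₗ[ZMod 2] ZMod 2}
    {c : Fin d → V} (hP : ∀ v, v = P v + ∑ j, f j v • c j)
    (h : PrankDecompOn k Finset.univ m (fun x => α fun i => P (x i))) :
    PrankDecompOn k Finset.univ (m + k * d) α := by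
  let L (S : Finset (Fin k)) (i : Fin k) : V →ₗ[ZMod 2] V := if i ∈ S then P else LinearMap.id
  let A (S : Finset (Fin k)) (x : Fin k → V) : ZMod 2 := α fun i => L S i (x i)
  have hA (S : Finset (Fin k)) : IsMultilinear k (A S) := MultilinearOn.comp_linearMap hα (L S)
  suffices H : ∀ S, ∃ δ, PrankDecompOn k Finset.univ (S.card * d) δ ∧
      ∀ x, α x = A S x + δ x by
    obtain ⟨δ, hδ, hαδ⟩ := H Finset.univ
    have := h.add hδ
    rw [Finset.card_fin] at this
    convert this using 1
    ext x
    simp [hαδ x, A, L]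
  intro S
  induction S using Finset.induction_on with
  | empty =>
    exact ⟨fun _ => 0, by simp [PrankDecompOn.zero], fun x => by simp [A, L]⟩
  | insert i S hi ih =>
    obtain ⟨δ, hδ, hαδ⟩ := ih
    refine ⟨_, by
      rw [Finset.card_insert_of_notMem hi, add_one_mul]
      exact hδ.add ((hA S).prankDecompOn_sum hk i f c), fun x => ?_⟩
    have hins : A (insert i S) x = A S (Function.update x i (P (x i))) := by
      refine congrArg α (funext fun j => ?_)
      rcases eq_or_ne j i with rfl | hji
      · simp [L, hi]
      · simp [L, hji]
    rw [hαδ, (hA S).eq_update_add_sum hP i x, hins]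
    ring

lemma IsMultilinear.exists_prankDecompOn [Module.Finite (ZMod 2) V] (hk : 2 ≤ k)
    {α : (Fin k → V) → ZMod 2} (hα : IsMultilinear k α) :
    ∃ m, PrankDecompOn k Finset.univ m α := by
  let b := Module.finBasis (ZMod 2) V
  refine ⟨_, hα.prankDecompOn_of_comp hk (m := 0) (P := 0) (f := b.coord) (c := b)
    (fun v => by simp) ?_⟩
  convert PrankDecompOn.zero (V := V) (k := k) Finset.univ with x
  let i : Fin k := ⟨0, by omega⟩
  have := hα.2 i (Finset.mem_univ i) 0 0 0
  simpa [Pi.zero_def] using this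

lemma prank_eq_zero_of_lt_two (hk : k < 2) (α : (Fin k → V) → ZMod 2) : prank k α = 0 := by
  rw [prank, prankOn, Nat.sInf_eq_zero, or_iff_not_imp_right]
  intro hne
  obtain ⟨m, hm⟩ := Set.nonempty_iff_ne_empty.mpr hne
  obtain rfl | hpos := m.eq_zero_or_pos
  · exact hm
  obtain ⟨I, -, -, -, h₁, h₂, -⟩ := hm
  have hlt := Finset.card_lt_card (Finset.ssubset_univ_iff.2 (h₂ ⟨0, hpos⟩))
  have hI := Finset.card_pos.2 (Finset.nonempty_iff_ne_empty.2 (h₁ ⟨0, hpos⟩))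
  rw [Finset.card_fin] at hlt
  omega

end PartitionRank

/-- **Lemma (partition rank and restriction to a subspace).**
If `U ≤ G` has codimension `d`, then `prank(α) ≤ prank(α|_{U×⋯×U}) + k·d`. -/
theorem statement8 (n k d : ℕ) (α : (Fin k → (Fin n → ZMod 2)) → ZMod 2)
    (hα : IsMultilinear k α) (U : Submodule (ZMod 2) (Fin n → ZMod 2))
    (hd : Module.finrank (ZMod 2) ((Fin n → ZMod 2) ⧸ U) = d) :
    prank k α ≤
      prank k (fun x : Fin k → U => α fun i => (x i : Fin n → ZMod 2)) + k * d := by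
  rcases lt_or_ge k 2 with hk | hk
  · simp [prank_eq_zero_of_lt_two hk]
  obtain ⟨s, hs⟩ := U.mkQ.exists_rightInverse_of_surjective U.range_mkQ
  have hs' (q) : U.mkQ (s q) = q := LinearMap.congr_fun hs q
  let b := Module.finBasisOfFinrankEq (ZMod 2) _ hd
  let P : (Fin n → ZMod 2) →ₗ[ZMod 2] U := (LinearMap.id - s ∘ₗ U.mkQ).codRestrict U fun v => by
    rw [← Submodule.Quotient.mk_eq_zero, ← Submodule.mkQ_apply]
    simp only [LinearMap.sub_apply, LinearMap.comp_apply, LinearMap.id_apply, map_sub, hs',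
      sub_self]
  have hαU : IsMultilinear k (fun x : Fin k → U => α fun i => (x i : Fin n → ZMod 2)) :=
    MultilinearOn.comp_linearMap hα fun _ => U.subtype
  have hU := Nat.sInf_mem (hαU.exists_prankDecompOn hk)
  refine Nat.sInf_le (hα.prankDecompOn_of_comp hk (P := U.subtype ∘ₗ P)
    (f := fun j => b.coord j ∘ₗ U.mkQ) (c := fun j => s (b j)) (fun v => ?_)
    (PrankDecompOn.comp_linearMap hU P))
  have hsum : ∑ j, (b.coord j ∘ₗ U.mkQ) v • s (b j) = s (U.mkQ v) := by
    conv_rhs => rw [← b.sum_repr (U.mkQ v), map_sum]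
    simp only [map_smul]
    rfl
  rw [hsum]
  exact (sub_add_cancel v (s (U.mkQ v))).symm
end

section
/- For every k there exist constants C ≥ 1 and D ≥ 1, depending only on k, such that the following holds. Let φ : G^k → 𝔽₂ be a multilinear form and let 𝒫 be a down-set of partitions of [k]. Suppose φ(x_{[k]}) = Σ_{i∈[r]} β_{i,1}(x_{I_{i,1}})⋯β_{i,d_i}(x_{I_{i,d_i}}) where each β_{i,j} is a multilinear form and each partition {I_{i,1}, …, I_{i,d_i}} belongs to 𝒫. Then there exists another decomposition φ(x_{[k]}) = Σ_{i∈[r']} β'_{i,1}(x_{I'_{i,1}})⋯β'_{i,d'_i}(x_{I'_{i,d'_i}}) with r' ≤ C·r^D, in which each partition {I'_{i,1}, …, I'_{i,d'_i}} belongs to 𝒫 and each factor is a slice of φ, i.e. β'_{i,j}(x_{I'_{i,j}}) = φ(x_{I'_{i,j}}, y_{[k]∖I'_{i,j}}) for some fixed y_{[k]∖I'_{i,j}} ∈ G^{[k]∖I'_{i,j}}. -/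
open Finset

/-- A finite set of finsets is a partition of `[k]` (into nonempty parts). -/
def IsPartitionSet (k : ℕ) (P : Finset (Finset (Fin k))) : Prop :=
  (∅ ∉ P) ∧ (∀ a ∈ P, ∀ b ∈ P, a ≠ b → Disjoint a b) ∧ P.sup id = Finset.univ

/-- `A` refines `B`: every block of `B` is a union of blocks of `A`. -/
def Refines (k : ℕ) (A B : Finset (Finset (Fin k))) : Prop :=
  ∀ b ∈ B, ∃ T ⊆ A, T.sup id = b

/-- `β` is the slice of `φ` in the variables indexed by `J`, for some fixed values of the
remaining variables. -/
def IsSlice {V : Type*} {k : ℕ} (φ : (Fin k → V) → ZMod 2) (J : Finset (Fin k))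
    (β : (Fin k → V) → ZMod 2) : Prop :=
  ∃ y : Fin k → V, ∀ x, β x = φ (J.piecewise x y)

/-- `f` is a product of multilinear forms over the blocks of a partition satisfying `P`, the
factors on blocks belonging to `F` being slices of `φ`. -/
def IsTerm {V : Type*} [AddCommGroup V] [Module (ZMod 2) V] {k : ℕ}
    (φ : (Fin k → V) → ZMod 2) (P : Finset (Finset (Fin k)) → Prop)
    (F : Finset (Finset (Fin k))) (f : (Fin k → V) → ZMod 2) : Prop :=
  ∃ (A : Finset (Finset (Fin k))) (β : Finset (Fin k) → (Fin k → V) → ZMod 2),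
    IsPartitionSet k A ∧ P A ∧ (∀ J ∈ A, MultilinearOn k J (β J)) ∧
    (∀ J ∈ A, J ∈ F → IsSlice φ J (β J)) ∧ f = fun x => ∏ J ∈ A, β J x

/-- `f` is a sum of at most `r` elements satisfying `Q`. -/
def IsSumOfAtMost {M : Type*} [AddCommMonoid M] (Q : M → Prop) (r : ℕ) (f : M) : Prop :=
  ∃ l : List M, l.length ≤ r ∧ (∀ g ∈ l, Q g) ∧ l.sum = f

namespace IsSumOfAtMost

variable {M : Type*} [AddCommMonoid M] {Q : M → Prop}

lemma zero (r : ℕ) : IsSumOfAtMost Q r 0 := ⟨[], by simp⟩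

lemma of_mem {f : M} (h : Q f) : IsSumOfAtMost Q 1 f := ⟨[f], by simpa⟩

lemma mono {r s : ℕ} {f : M} (h : IsSumOfAtMost Q r f) (hrs : r ≤ s) : IsSumOfAtMost Q s f := by
  obtain ⟨l, h1, h2⟩ := h
  exact ⟨l, h1.trans hrs, h2⟩

lemma add {r s : ℕ} {f g : M} (hf : IsSumOfAtMost Q r f) (hg : IsSumOfAtMost Q s g) :
    IsSumOfAtMost Q (r + s) (f + g) := by
  obtain ⟨l, h1, h2, rfl⟩ := hf
  obtain ⟨l', h1', h2', rfl⟩ := hg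
  refine ⟨l ++ l', by simp; omega, ?_, by simp⟩
  intro g hg
  rcases List.mem_append.1 hg with h | h
  exacts [h2 g h, h2' g h]

lemma sum {ι : Type*} (s : Finset ι) {r : ℕ} {f : ι → M}
    (h : ∀ i ∈ s, IsSumOfAtMost Q r (f i)) : IsSumOfAtMost Q (s.card * r) (∑ i ∈ s, f i) := by
  classical
  induction s using Finset.induction_on with
  | empty => exact zero _
  | insert a s ha ih =>
    rw [Finset.sum_insert ha]
    refine ((h a (by simp)).add (ih fun i hi => h i (by simp [hi]))).mono ?_
    rw [Finset.card_insert_of_notMem ha]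
    exact le_of_eq (by ring)

lemma smul [Module (ZMod 2) M] (c : ZMod 2) {r : ℕ} {f : M} (h : IsSumOfAtMost Q r f) :
    IsSumOfAtMost Q r (c • f) := by
  obtain rfl | rfl : c = 0 ∨ c = 1 := by revert c; decide
  · rw [zero_smul]; exact zero _
  · rwa [one_smul]

lemma exists_fin {r : ℕ} {f : M} (h : IsSumOfAtMost Q r f) :
    ∃ m ≤ r, ∃ g : Fin m → M, (∀ i, Q (g i)) ∧ ∑ i, g i = f := by
  obtain ⟨l, h1, h2, rfl⟩ := h
  exact ⟨l.length, h1, fun i => l[i], fun i => h2 _ (by simp), by simp⟩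

end IsSumOfAtMost

/-- Skeleton decomposition: the matrix `(γ t x)` factors through at most `|ι|` of its columns. -/
lemma exists_skeleton {K ι X : Type*} [Field K] [Fintype ι] (γ : ι → X → K) :
    ∃ d ≤ Fintype.card ι, ∃ (y : Fin d → X) (c : ι → Fin d → K),
      ∀ t x, γ t x = ∑ b, ∑ a, c a b * γ a x * γ t (y b) := by
  classical
  let col : X → ι → K := fun x t => γ t x
  obtain ⟨w, hw, hspan, hli⟩ := Submodule.exists_fun_fin_finrank_span_eq K (Set.range col)
  choose y hy using hw
  have hker : LinearMap.ker (Fintype.linearCombination K w) = ⊥ := by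
    rw [LinearMap.ker_eq_bot]
    exact linearIndependent_iff_injective_fintypeLinearCombination.1 hli
  obtain ⟨g, hg⟩ := LinearMap.exists_leftInverse_of_injective _ hker
  refine ⟨_, (Submodule.finrank_le _).trans (by simp), y, fun a b => g (Pi.single a 1) b, ?_⟩
  intro t x
  have hx : col x ∈ Submodule.span K (Set.range w) := by
    rw [hspan]; exact Submodule.subset_span ⟨x, rfl⟩
  obtain ⟨v, hv⟩ : ∃ v, Fintype.linearCombination K w v = col x := by
    rw [← Fintype.range_linearCombination] at hx; exact hx
  have hgv : g (col x) = v := by rw [← hv]; exact LinearMap.congr_fun hg v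
  have hge : ∀ b, g (col x) b = ∑ a, g (Pi.single a 1) b * γ a x := by
    intro b
    have : col x = ∑ a, γ a x • (Pi.single a 1 : ι → K) := by
      ext t; simp [Finset.sum_apply, Pi.single_apply, col]
    rw [this, map_sum, Finset.sum_apply]
    simp [mul_comm]
  have := congrFun hv t
  rw [← hgv, Fintype.linearCombination_apply, Finset.sum_apply] at this
  rw [show γ t x = col x t from rfl, ← this]
  refine Finset.sum_congr rfl fun b _ => ?_
  rw [← Finset.sum_mul, ← hge, ← hy]
  rfl

section Forms

variable {V : Type*} [AddCommGroup V] [Module (ZMod 2) V] {k : ℕ}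

lemma MultilinearOn.piecewise {S : Finset (Fin k)} {β : (Fin k → V) → ZMod 2}
    (h : MultilinearOn k S β) (I : Finset (Fin k)) (y : Fin k → V) :
    MultilinearOn k (I ∩ S) (fun x => β (I.piecewise x y)) := by
  refine ⟨fun x x' hx => h.1 _ _ fun i hi => ?_, fun i hi x u v => ?_⟩
  · by_cases hI : i ∈ I
    · simpa [hI] using hx i (by simp [hI, hi])
    · simp [hI]
  · rw [Finset.mem_inter] at hi
    simp only [← Finset.update_piecewise_of_mem _ _ _ hi.1]
    exact h.2 i hi.2 _ u v

lemma IsSlice.multilinearOn {φ β : (Fin k → V) → ZMod 2} (hφ : IsMultilinear k φ)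
    {J : Finset (Fin k)} (h : IsSlice φ J β) : MultilinearOn k J β := by
  obtain ⟨y, hy⟩ := h
  have := MultilinearOn.piecewise hφ J y
  rw [Finset.inter_univ] at this
  rwa [funext hy]

lemma MultilinearOn.piecewise_eq_right {S : Finset (Fin k)} {β : (Fin k → V) → ZMod 2}
    (h : MultilinearOn k S β) {I : Finset (Fin k)} (hI : Disjoint I S) (x y : Fin k → V) :
    β (I.piecewise x y) = β y :=
  h.1 _ _ fun _ hi => Finset.piecewise_eq_of_notMem _ _ _ (Finset.disjoint_right.1 hI hi)

lemma MultilinearOn.piecewise_eq_left {S : Finset (Fin k)} {β : (Fin k → V) → ZMod 2}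
    (h : MultilinearOn k S β) (x y : Fin k → V) : β (S.piecewise x y) = β x :=
  h.1 _ _ fun _ hi => Finset.piecewise_eq_of_mem _ _ _ hi

/-- Splitting a block `I` of `A` into the blocks of `B` gives a partition refining `A`. -/
lemma IsPartitionSet.split {A B : Finset (Finset (Fin k))} {I : Finset (Fin k)}
    (hA : IsPartitionSet k A) (hI : I ∈ A) (hB0 : ∅ ∉ B)
    (hBd : ∀ a ∈ B, ∀ b ∈ B, a ≠ b → Disjoint a b) (hBI : B.sup id = I) :
    IsPartitionSet k (A.erase I ∪ B) ∧ Refines k (A.erase I ∪ B) A := by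
  have hle : ∀ K ∈ B, K ⊆ I := fun K hK => hBI ▸ Finset.le_sup (f := id) hK
  refine ⟨⟨?_, ?_, ?_⟩, ?_⟩
  · simp [hA.1, hB0]
  · have key : ∀ a ∈ A.erase I, ∀ b ∈ B, Disjoint a b := fun a ha b hb =>
      (hA.2.1 a (Finset.mem_of_mem_erase ha) I hI (Finset.ne_of_mem_erase ha)).mono_right (hle b hb)
    intro a ha b hb hab
    rcases Finset.mem_union.1 ha with ha | ha <;> rcases Finset.mem_union.1 hb with hb | hb
    · exact hA.2.1 a (Finset.mem_of_mem_erase ha) b (Finset.mem_of_mem_erase hb) hab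
    · exact key a ha b hb
    · exact (key b hb a ha).symm
    · exact hBd a ha b hb hab
  · rw [Finset.sup_union, hBI, ← hA.2.2, ← Finset.insert_erase hI, Finset.sup_insert, sup_comm]
    simp
  · intro b hb
    by_cases h : b = I
    · exact ⟨B, Finset.subset_union_right, hBI.trans h.symm⟩
    · exact ⟨{b}, by simp [h, hb], by simp⟩

lemma IsTerm.split {φ : (Fin k → V) → ZMod 2} {P : Finset (Finset (Fin k)) → Prop}
    (hP : ∀ A B, IsPartitionSet k A → IsPartitionSet k B → Refines k A B → P B → P A)
    {F A B : Finset (Finset (Fin k))} {I : Finset (Fin k)}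
    {β δ : Finset (Fin k) → (Fin k → V) → ZMod 2}
    (hA : IsPartitionSet k A) (hPA : P A) (hβ : ∀ J ∈ A, MultilinearOn k J (β J))
    (hβs : ∀ J ∈ A, J ∈ F → IsSlice φ J (β J)) (hI : I ∈ A) (hB0 : ∅ ∉ B)
    (hBd : ∀ a ∈ B, ∀ b ∈ B, a ≠ b → Disjoint a b) (hBI : B.sup id = I)
    (hδ : ∀ K ∈ B, MultilinearOn k K (δ K))
    (hδs : ∀ K ∈ B, K ∈ insert I F → IsSlice φ K (δ K)) :
    IsTerm φ P (insert I F) (fun x => (∏ J ∈ A.erase I, β J x) * ∏ K ∈ B, δ K x) := by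
  obtain ⟨hp, hr⟩ := hA.split hI hB0 hBd hBI
  have hdisj : Disjoint (A.erase I) B := by
    rw [Finset.disjoint_left]
    intro J hJ hJB
    have hJI : J ⊆ I := hBI ▸ Finset.le_sup (f := id) hJB
    have hd := hA.2.1 J (Finset.mem_of_mem_erase hJ) I hI (Finset.ne_of_mem_erase hJ)
    have : J = ∅ := by simpa using (disjoint_self.1 (hd.mono_right hJI))
    exact hB0 (this ▸ hJB)
  have hnot : ∀ J ∈ A.erase I, J ∉ B := fun J hJ => Finset.disjoint_left.1 hdisj hJ
  refine ⟨A.erase I ∪ B, fun K => if K ∈ B then δ K else β K, hp, hP _ _ hp hA hr hPA, ?_, ?_, ?_⟩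
  · intro J hJ
    by_cases h : J ∈ B
    · simpa [h] using hδ J h
    · simp only [h, if_false]
      rw [Finset.mem_union, or_iff_left h] at hJ
      exact hβ J (Finset.mem_of_mem_erase hJ)
  · intro J hJ hJF
    by_cases h : J ∈ B
    · simpa [h] using hδs J h hJF
    · simp only [h, if_false]
      rw [Finset.mem_union, or_iff_left h] at hJ
      refine hβs J (Finset.mem_of_mem_erase hJ) ?_
      exact (Finset.mem_insert.1 hJF).resolve_left (Finset.ne_of_mem_erase hJ)
  · funext x
    rw [Finset.prod_union hdisj]
    congr 1
    · exact Finset.prod_congr rfl fun J hJ => by simp [hnot J hJ]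
    · exact Finset.prod_congr rfl fun J hJ => by simp [hJ]

/-- Fixing the variables outside `I` in a product over the blocks of a partition `A` gives, up
to a constant, a product over the partition of `I` induced by `A`. -/
lemma exists_induced_product {φ : (Fin k → V) → ZMod 2} {F A : Finset (Finset (Fin k))}
    {I : Finset (Fin k)} (hF : ∀ J K, J ∈ F → J ⊆ K → K ∈ F) (hIF : I ∉ F)
    (hI : ∀ J, I ⊂ J → J ∈ F) {β : Finset (Fin k) → (Fin k → V) → ZMod 2}
    (hA : IsPartitionSet k A) (hβ : ∀ J ∈ A, MultilinearOn k J (β J))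
    (hβs : ∀ J ∈ A, J ∈ F → IsSlice φ J (β J)) (hIA : I ∉ A) (y : Fin k → V) :
    ∃ (B : Finset (Finset (Fin k))) (δ : Finset (Fin k) → (Fin k → V) → ZMod 2) (c : ZMod 2),
      ∅ ∉ B ∧ (∀ a ∈ B, ∀ b ∈ B, a ≠ b → Disjoint a b) ∧ B.sup id = I ∧
      (∀ K ∈ B, MultilinearOn k K (δ K)) ∧
      (∀ K ∈ B, K ∈ insert I F → IsSlice φ K (δ K)) ∧
      ∀ x, ∏ J ∈ A, β J (I.piecewise x y) = c * ∏ K ∈ B, δ K x := by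
  classical
  set A' := A.filter (fun J => ¬ Disjoint I J) with hA'
  have hinj : Set.InjOn (fun J => I ∩ J) (A' : Set (Finset (Fin k))) := by
    intro J hJ J' hJ' h
    simp only [hA', Finset.coe_filter, Set.mem_ofPred_eq] at hJ hJ'
    by_contra hne
    obtain ⟨i, hiI, hiJ⟩ := Finset.not_disjoint_iff.1 hJ.2
    have : i ∈ I ∩ J' := by rw [← show I ∩ J = I ∩ J' from h]; simp [hiI, hiJ]
    exact Finset.disjoint_left.1 (hA.2.1 J hJ.1 J' hJ'.1 hne) hiJ (Finset.mem_inter.1 this).2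
  let inv := Function.invFunOn (fun J => I ∩ J) (A' : Set (Finset (Fin k)))
  have hinv : ∀ J ∈ A', inv (I ∩ J) = J := fun J hJ => hinj.leftInvOn_invFunOn hJ
  refine ⟨A'.image (fun J => I ∩ J), fun K x => β (inv K) (I.piecewise x y),
    ∏ J ∈ A.filter (fun J => ¬ ¬ Disjoint I J), β J y, ?_, ?_, ?_, ?_, ?_, ?_⟩
  · simp only [Finset.mem_image, not_exists, not_and]
    intro J hJ h
    exact (Finset.mem_filter.1 hJ).2 (Finset.disjoint_iff_inter_eq_empty.2 h)
  · simp only [Finset.forall_mem_image]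
    intro J hJ J' hJ' hne
    have hJJ : J ≠ J' := fun h => hne (by rw [h])
    exact (hA.2.1 J (Finset.mem_filter.1 hJ).1 J' (Finset.mem_filter.1 hJ').1 hJJ).mono
      Finset.inter_subset_right Finset.inter_subset_right
  · ext i
    simp only [Finset.sup_image, Finset.mem_sup, Function.comp, id, Finset.mem_inter]
    constructor
    · rintro ⟨J, -, h, -⟩; exact h
    · intro hi
      have : i ∈ A.sup id := by rw [hA.2.2]; simp
      obtain ⟨J, hJ, hiJ⟩ := Finset.mem_sup.1 this
      exact ⟨J, Finset.mem_filter.2 ⟨hJ, Finset.not_disjoint_iff.2 ⟨i, hi, hiJ⟩⟩, hi, hiJ⟩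
  · simp only [Finset.forall_mem_image]
    intro J hJ
    rw [hinv J hJ]
    exact (hβ J (Finset.mem_filter.1 hJ).1).piecewise I y
  · simp only [Finset.forall_mem_image]
    intro J hJ hK
    rw [hinv J hJ]
    have hJA := (Finset.mem_filter.1 hJ).1
    rcases Finset.mem_insert.1 hK with hK | hK
    · have hIJ : I ⊆ J := Finset.inter_eq_left.1 hK
      have hne : I ≠ J := fun h => hIA (h ▸ hJA)
      obtain ⟨z, hz⟩ := hβs J hJA (hI J (Finset.ssubset_iff_subset_ne.2 ⟨hIJ, hne⟩))
      refine ⟨J.piecewise y z, fun x => ?_⟩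
      rw [hK]
      refine (hz _).trans ?_
      congr 1
      funext i
      by_cases hi : i ∈ I
      · simp [hi, hIJ hi]
      · by_cases hj : i ∈ J <;> simp [hi, hj]
    · exact absurd (hF _ I hK Finset.inter_subset_left) hIF
  · intro x
    rw [Finset.prod_image hinj, mul_comm, ← Finset.prod_filter_mul_prod_filter_not A
      (fun J => ¬ Disjoint I J)]
    congr 1
    · exact Finset.prod_congr rfl fun J hJ => by simp only [hinv J hJ]
    · refine Finset.prod_congr rfl fun J hJ => ?_
      rw [Finset.mem_filter, not_not] at hJ
      exact (hβ J hJ.1).piecewise_eq_right hJ.2 x y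

/-- All factors on the block `I` can be replaced by slices, provided this has already been done
for all larger blocks. -/
lemma IsSumOfAtMost.insert_slice {φ : (Fin k → V) → ZMod 2} (hφ : IsMultilinear k φ)
    {P : Finset (Finset (Fin k)) → Prop}
    (hP : ∀ A B, IsPartitionSet k A → IsPartitionSet k B → Refines k A B → P B → P A)
    {F : Finset (Finset (Fin k))} {I : Finset (Fin k)}
    (hF : ∀ J K, J ∈ F → J ⊆ K → K ∈ F) (hIF : I ∉ F) (hI : ∀ J, I ⊂ J → J ∈ F) {r : ℕ}
    (h : IsSumOfAtMost (IsTerm φ P F) r φ) :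
    IsSumOfAtMost (IsTerm φ P (insert I F)) (3 * r ^ 3) φ := by
  classical
  obtain ⟨m, hm, f, hf, hsum⟩ := h.exists_fin
  choose A β hA hPA hβ hβs hfβ using hf
  let γ : {t // I ∈ A t} → (Fin k → V) → ZMod 2 := fun t x => ∏ J ∈ (A t).erase I, β t J x
  let N : (Fin k → V) → ZMod 2 := ∑ t : {t // I ∉ A t}, f t
  have hγ : ∀ t x y, γ t (I.piecewise x y) = γ t y := fun t x y =>
    Finset.prod_congr rfl fun J hJ =>
      (hβ t J (Finset.mem_of_mem_erase hJ)).piecewise_eq_right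
        (hA t |>.2.1 _ t.2 _ (Finset.mem_of_mem_erase hJ) (Finset.ne_of_mem_erase hJ).symm) x y
  have hφN : ∀ x, φ x = ∑ t, β (t : {t // I ∈ A t}) I x * γ t x + N x := by
    intro x
    conv_lhs => rw [← hsum, ← Fintype.sum_subtype_add_sum_subtype (fun t => I ∈ A t) f]
    rw [Pi.add_apply, Finset.sum_apply]
    congr 1
    refine Finset.sum_congr rfl fun t _ => ?_
    rw [hfβ]
    exact (Finset.mul_prod_erase _ (fun J => β t J x) t.2).symm
  have hφN' : ∀ x y, ∑ t, β (t : {t // I ∈ A t}) I x * γ t y =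
      φ (I.piecewise x y) + N (I.piecewise x y) := by
    intro x y
    rw [hφN (I.piecewise x y), add_assoc, CharTwo.add_self_eq_zero, add_zero]
    refine Finset.sum_congr rfl fun t _ => ?_
    rw [hγ, (hβ t I t.2).piecewise_eq_left]
  obtain ⟨d, hd, y, c, hc⟩ := exists_skeleton γ
  have hφ_eq : φ = N + ∑ b, ∑ a, c a b • ((fun x => γ a x * φ (I.piecewise x (y b))) +
      ∑ t : {t // I ∉ A t}, fun x => γ a x * f t (I.piecewise x (y b))) := by
    funext x
    rw [hφN x, add_comm, Pi.add_apply]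
    congr 1
    simp only [Finset.sum_apply, Pi.smul_apply, Pi.add_apply, ← Finset.mul_sum, ← mul_add,
      smul_eq_mul]
    have hNs : ∀ b, ∑ t : {t // I ∉ A t}, f t (I.piecewise x (y b)) = N (I.piecewise x (y b)) :=
      fun b => (Finset.sum_apply _ _ _).symm
    simp only [hNs, ← hφN']
    calc _ = ∑ t : {t // I ∈ A t}, ∑ b, ∑ a, β t I x * (c a b * γ a x * γ t (y b)) := by
          refine Finset.sum_congr rfl fun t _ => ?_
          rw [hc t x]; simp only [Finset.mul_sum]
      _ = _ := by
          rw [Finset.sum_comm]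
          refine Finset.sum_congr rfl fun b _ => ?_
          rw [Finset.sum_comm]
          refine Finset.sum_congr rfl fun a _ => ?_
          simp only [Finset.mul_sum]
          refine Finset.sum_congr rfl fun t _ => by ring
  have hN : IsSumOfAtMost (IsTerm φ P (insert I F)) (m * 1) N := by
    refine (IsSumOfAtMost.sum (r := 1) Finset.univ fun t _ => .of_mem ?_).mono ?_
    · refine ⟨A t, β t, hA t, hPA t, hβ t, fun J hJ hJF => hβs t J hJ ?_, hfβ t⟩
      exact (Finset.mem_insert.1 hJF).resolve_left fun h => t.2 (h ▸ hJ)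
    · exact Nat.mul_le_mul_right _ ((Fintype.card_subtype_le _).trans (by simp))
  have hslice : ∀ a b, IsTerm φ P (insert I F) (fun x => γ a x * φ (I.piecewise x (y b))) := by
    intro a b
    have hne : ∅ ≠ I := fun h => (hA a).1 (h ▸ a.2)
    have hs : IsSlice φ I (fun x => φ (I.piecewise x (y b))) := ⟨y b, fun _ => rfl⟩
    have := IsTerm.split (B := {I}) (δ := fun _ x => φ (I.piecewise x (y b))) hP (hA a) (hPA a)
      (hβ a) (hβs a) a.2 (by simpa using hne) (by simp) (by simp)
      (by simpa using hs.multilinearOn hφ) (by simpa using hs)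
    simpa using this
  have hprod : ∀ a b (t : {t // I ∉ A t}), IsSumOfAtMost (IsTerm φ P (insert I F)) 1
      (fun x => γ a x * f t (I.piecewise x (y b))) := by
    intro a b t
    obtain ⟨B, δ, e, hB0, hBd, hBI, hδ, hδs, he⟩ :=
      exists_induced_product hF hIF hI (hA t) (hβ t) (hβs t) t.2 (y b)
    have := (IsSumOfAtMost.of_mem (IsTerm.split hP (hA a) (hPA a) (hβ a) (hβs a) a.2 hB0 hBd hBI
      hδ hδs)).smul e
    convert this using 1
    funext x
    rw [hfβ, Pi.smul_apply, smul_eq_mul]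
    simp only [he]
    ring
  have hall : IsSumOfAtMost (IsTerm φ P (insert I F)) (m * 1 + m * (m * (1 + m * 1))) φ := by
    have hcard : ∀ (p : Fin m → Prop) [Fintype {t // p t}], Fintype.card {t // p t} ≤ m :=
      fun p _ => (Fintype.card_subtype_le p).trans (by simp)
    have := hN.add (IsSumOfAtMost.sum Finset.univ fun b _ => IsSumOfAtMost.sum Finset.univ
      fun a _ => ((IsSumOfAtMost.of_mem (hslice a b)).add
        (IsSumOfAtMost.sum Finset.univ fun t _ => hprod a b t)).smul (c a b))
    rw [← hφ_eq] at this
    refine this.mono ?_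
    simp only [Finset.card_univ, Fintype.card_fin]
    gcongr
    · exact hd.trans (hcard _)
    · exact hcard _
    · exact hcard _
  refine hall.mono ?_
  calc m * 1 + m * (m * (1 + m * 1)) = m + m ^ 2 + m ^ 3 := by ring
    _ ≤ m ^ 3 + m ^ 3 + m ^ 3 := by
        rcases Nat.eq_zero_or_pos m with rfl | h0
        · simp
        · gcongr
          · exact Nat.le_self_pow (by norm_num) m
          · norm_num
    _ = 3 * m ^ 3 := by ring
    _ ≤ 3 * r ^ 3 := by gcongr

lemma IsSumOfAtMost.univ_slice {φ : (Fin k → V) → ZMod 2} (hφ : IsMultilinear k φ)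
    {P : Finset (Finset (Fin k)) → Prop}
    (hP : ∀ A B, IsPartitionSet k A → IsPartitionSet k B → Refines k A B → P B → P A)
    (m : ℕ) (F : Finset (Finset (Fin k))) (hF : ∀ J K, J ∈ F → J ⊆ K → K ∈ F)
    (hm : Fᶜ.card = m) (r : ℕ) (h : IsSumOfAtMost (IsTerm φ P F) r φ) :
    IsSumOfAtMost (IsTerm φ P Finset.univ) ((fun r => 3 * r ^ 3)^[m] r) φ := by
  induction m generalizing F r with
  | zero =>
    rw [Finset.card_eq_zero, Finset.compl_eq_empty_iff] at hm
    simpa [hm] using h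
  | succ m ih =>
    have hne : Fᶜ.Nonempty := Finset.card_pos.1 (by omega)
    obtain ⟨I, hI⟩ := Fᶜ.exists_maximal hne
    have hIF : I ∉ F := Finset.mem_compl.1 hI.prop
    have hlt : ∀ J, I ⊂ J → J ∈ F := fun J hJ => by
      by_contra hJF
      exact hI.not_gt (Finset.mem_compl.2 hJF) hJ
    rw [Function.iterate_succ_apply]
    refine ih (insert I F) ?_ ?_ _ (h.insert_slice hφ hP hF hIF hlt)
    · intro J K hJ hJK
      rcases Finset.mem_insert.1 hJ with rfl | hJ
      · rcases eq_or_ssubset_of_subset hJK with rfl | hs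
        · simp
        · simp [hlt K hs]
      · simp [hF J K hJ hJK]
    · rw [Finset.compl_insert, Finset.card_erase_of_mem hI.prop, hm]
      rfl

/-- A product indexed by a family of blocks partitioning the variables is a term. -/
lemma isTerm_of_family {φ : (Fin k → V) → ZMod 2} {P : Finset (Finset (Fin k)) → Prop} {d : ℕ}
    {I : Fin d → Finset (Fin k)} {β : Fin d → (Fin k → V) → ZMod 2} (hne : ∀ j, I j ≠ ∅)
    (hdisj : ∀ j j', j ≠ j' → Disjoint (I j) (I j')) (hun : Finset.univ.biUnion I = Finset.univ)
    (hβ : ∀ j, MultilinearOn k (I j) (β j)) (hP : P (Finset.univ.image I)) :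
    IsTerm φ P ∅ (fun x => ∏ j, β j x) := by
  have hinj : Function.Injective I := by
    intro j j' h
    by_contra hjj
    have := hdisj j j' hjj
    rw [h, disjoint_self] at this
    exact hne j' this
  refine ⟨Finset.univ.image I, fun K x => ∏ j with I j = K, β j x, ⟨?_, ?_, ?_⟩, hP, ?_,
    by simp, ?_⟩
  · simpa using hne
  · simp only [Finset.forall_mem_image]
    intro j _ j' _ h
    exact hdisj j j' fun e => h (by rw [e])
  · rw [← hun, Finset.sup_image, Finset.sup_eq_biUnion]
    rfl
  · simp only [Finset.forall_mem_image]
    intro j _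
    simpa [hinj.eq_iff, Finset.filter_eq'] using hβ j
  · funext x
    exact (Finset.prod_fiberwise_of_maps_to
      (fun j _ => Finset.mem_image_of_mem I (Finset.mem_univ j)) _).symm

end Forms

lemma exists_iterate_le_mul_pow (m : ℕ) :
    ∃ C D : ℕ, 1 ≤ C ∧ 1 ≤ D ∧ ∀ r : ℕ, (fun r => 3 * r ^ 3)^[m] r ≤ C * r ^ D := by
  induction m with
  | zero => exact ⟨1, 1, le_rfl, le_rfl, by simp⟩
  | succ m ih =>
    obtain ⟨C, D, hC, hD, h⟩ := ih
    refine ⟨C * 3 ^ D, 3 * D, Nat.mul_pos hC (by positivity), by omega, fun r => ?_⟩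
    rw [Function.iterate_succ_apply]
    refine (h _).trans (le_of_eq ?_)
    rw [mul_pow, ← pow_mul, mul_assoc]

/-- **Proposition 18 (slice decompositions within a down-set of partitions).**
For every `k` there are `C, D ≥ 1` such that: if `φ` has a decomposition into `r`
products of multilinear forms whose variable partitions lie in a down-set `P` of
partitions of `[k]`, then `φ` has a decomposition into at most `C·r^D` such products,
still with partitions in `P`, in which every factor is a slice of `φ`. -/
theorem statement12 (k : ℕ) (hk : 0 < k) :
    ∃ C D : ℝ, 1 ≤ C ∧ 1 ≤ D ∧
      ∀ (n : ℕ) (φ : (Fin k → (Fin n → ZMod 2)) → ZMod 2), IsMultilinear k φ →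
        ∀ (P : Finset (Finset (Fin k)) → Prop),
          (∀ A B, IsPartitionSet k A → IsPartitionSet k B → Refines k A B → P B → P A) →
          ∀ (r : ℕ) (d : Fin r → ℕ) (I : (i : Fin r) → Fin (d i) → Finset (Fin k))
            (β : (i : Fin r) → Fin (d i) → ((Fin k → (Fin n → ZMod 2)) → ZMod 2)),
            (∀ i, (∀ j, I i j ≠ ∅) ∧
              (∀ j j', j ≠ j' → Disjoint (I i j) (I i j')) ∧
              Finset.univ.biUnion (I i) = Finset.univ) →
            (∀ i j, MultilinearOn k (I i j) (β i j)) →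
            (∀ i, P (Finset.univ.image (I i))) →
            (∀ x, φ x = ∑ i, ∏ j, β i j x) →
            ∃ r' : ℕ, (r' : ℝ) ≤ C * (r : ℝ) ^ D ∧
              ∃ (d' : Fin r' → ℕ) (I' : (i : Fin r') → Fin (d' i) → Finset (Fin k))
                (β' : (i : Fin r') → Fin (d' i) → ((Fin k → (Fin n → ZMod 2)) → ZMod 2)),
                (∀ i, (∀ j, I' i j ≠ ∅) ∧
                  (∀ j j', j ≠ j' → Disjoint (I' i j) (I' i j')) ∧
                  Finset.univ.biUnion (I' i) = Finset.univ) ∧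
                (∀ i j, MultilinearOn k (I' i j) (β' i j)) ∧
                (∀ i, P (Finset.univ.image (I' i))) ∧
                (∀ i j, ∃ y : Fin k → (Fin n → ZMod 2),
                  ∀ x, β' i j x = φ (fun l => if l ∈ I' i j then x l else y l)) ∧
                (∀ x, φ x = ∑ i, ∏ j, β' i j x) := by
  obtain ⟨C, D, hC, hD, hCD⟩ := exists_iterate_le_mul_pow
    (∅ᶜ : Finset (Finset (Fin k))).card
  refine ⟨C, D, by exact_mod_cast hC, by exact_mod_cast hD, ?_⟩
  intro n φ hφ P hP r d I β hI hβ hPI hsum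
  have h0 : IsSumOfAtMost (IsTerm φ P ∅) r φ := by
    have := IsSumOfAtMost.sum (Q := IsTerm φ P ∅) (r := 1) (Finset.univ : Finset (Fin r))
      (f := fun i x => ∏ j, β i j x)
      fun i _ => .of_mem (isTerm_of_family (hI i).1 (hI i).2.1 (hI i).2.2 (hβ i) (hPI i))
    convert this using 1
    · simp
    · funext x
      simp [hsum x, Finset.sum_apply]
  obtain ⟨m, hm, f, hf, hfsum⟩ :=
    (h0.univ_slice hφ hP _ ∅ (by simp) rfl).exists_fin
  choose A δ hA hPA hδ hδs hfδ using hf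
  refine ⟨m, ?_, fun i => (A i).card, fun i j => ((A i).equivFin.symm j : Finset (Fin k)),
    fun i j => δ i ((A i).equivFin.symm j), fun i => ⟨fun j h => ?_, fun j j' h => ?_, ?_⟩,
    fun i j => hδ i _ (Subtype.prop _), fun i => ?_,
    fun i j => hδs i _ (Subtype.prop _) (Finset.mem_univ _), fun x => ?_⟩
  · rw [Real.rpow_natCast]
    exact_mod_cast hm.trans (hCD r)
  · exact (hA i).1 (h ▸ Subtype.prop _)
  · refine (hA i).2.1 _ (Subtype.prop _) _ (Subtype.prop _) fun e => h ?_
    exact (A i).equivFin.symm.injective (Subtype.ext e)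
  · rw [← (hA i).2.2]
    ext l
    simp only [Finset.mem_biUnion, Finset.mem_univ, true_and, Finset.mem_sup, id]
    exact ⟨fun ⟨j, hj⟩ => ⟨_, Subtype.prop _, hj⟩,
      fun ⟨J, hJ, hl⟩ => ⟨(A i).equivFin ⟨J, hJ⟩, by simpa using hl⟩⟩
  · convert hPA i
    ext J
    simp only [Finset.mem_image, Finset.mem_univ, true_and]
    exact ⟨fun ⟨j, hj⟩ => hj ▸ Subtype.prop _,
      fun hJ => ⟨(A i).equivFin ⟨J, hJ⟩, by simp⟩⟩
  · rw [← hfsum, Finset.sum_apply]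
    refine Finset.sum_congr rfl fun i _ => ?_
    rw [hfδ]
    exact (Finset.prod_coe_sort (A i) fun J => δ i J x).symm.trans
      ((A i).equivFin.symm.prod_comp fun J : A i => δ i J x).symm
end

section
/- Let k ≥ 4 and let α : G^k → 𝔽₂ be a multilinear form symmetric in its first 3 variables. Let φ = α + α∘(3 4). Then φ satisfies the identity φ + φ∘(1 3) + φ∘(1 4) = 0. Moreover, if φ is symmetric in its variables x₁ and x₄ (i.e. φ = φ∘(1 4)), then α is symmetric in its first 4 variables. -/
open Finset

theorem permForm_add {V : Type*} (k : ℕ) (π : Equiv.Perm (Fin k))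
    (α β : (Fin k → V) → ZMod 2) :
    permForm k π (α + β) = permForm k π α + permForm k π β := rfl

theorem permForm_permForm {V : Type*} (k : ℕ) (σ τ : Equiv.Perm (Fin k))
    (α : (Fin k → V) → ZMod 2) :
    permForm k σ (permForm k τ α) = permForm k (τ * σ) α := rfl

/-- If `α` is invariant under the transposition `(a b)`, then `α ∘ (b c) ∘ (a b) = α ∘ (a c)`. -/
theorem permForm_swap_permForm_swap {V : Type*} {k : ℕ} {α : (Fin k → V) → ZMod 2}
    {a b c : Fin k} (h : permForm k (Equiv.swap a b) α = α) (hca : c ≠ a) (hcb : c ≠ b) :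
    permForm k (Equiv.swap a b) (permForm k (Equiv.swap b c) α) =
      permForm k (Equiv.swap a c) α := by
  have hmul : Equiv.swap b c * Equiv.swap a b = Equiv.swap a b * Equiv.swap a c := by
    rw [Equiv.mul_swap_eq_swap_mul (Equiv.swap a b), Equiv.swap_apply_left,
      Equiv.swap_apply_of_ne_of_ne hca hcb]
  rw [permForm_permForm, hmul, ← permForm_permForm, h]

/-- If `α` is invariant under the transposition `(a b)`, then `α ∘ (b c) ∘ (a c) = α ∘ (b c)`. -/
theorem permForm_swap_permForm_swap_of_invariant {V : Type*} {k : ℕ}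
    {α : (Fin k → V) → ZMod 2} {a b c : Fin k}
    (h : permForm k (Equiv.swap a b) α = α) (hab : a ≠ b) (hca : c ≠ a) :
    permForm k (Equiv.swap a c) (permForm k (Equiv.swap b c) α) =
      permForm k (Equiv.swap b c) α := by
  have hmul : Equiv.swap b c * Equiv.swap a c = Equiv.swap a b * Equiv.swap b c := by
    rw [Equiv.mul_swap_eq_swap_mul (Equiv.swap b c),
      Equiv.swap_apply_of_ne_of_ne hab hca.symm, Equiv.swap_apply_right]
  rw [permForm_permForm, hmul, ← permForm_permForm, h]

/-- A form symmetric in its first `m` variables and invariant under exchanging one of them with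
the next variable is symmetric in its first `m + 1` variables. -/
theorem SymmetricInFirst.succ {V : Type*} {k m : ℕ} {α : (Fin k → V) → ZMod 2}
    (hsym : SymmetricInFirst k m α) {a c : Fin k} (ha : (a : ℕ) < m) (hc : (c : ℕ) = m)
    (h : permForm k (Equiv.swap a c) α = α) : SymmetricInFirst k (m + 1) α := by
  have key : ∀ i : Fin k, (i : ℕ) < m → permForm k (Equiv.swap i c) α = α := by
    intro i hi
    have hca : c ≠ a := by rintro rfl; omega
    have hci : c ≠ i := by rintro rfl; omega
    rw [← permForm_swap_permForm_swap (hsym i a hi ha) hci hca, h, hsym i a hi ha]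
  intro i j hi hj
  rcases Nat.lt_succ_iff_lt_or_eq.mp hi with hi' | hi' <;>
    rcases Nat.lt_succ_iff_lt_or_eq.mp hj with hj' | hj'
  · exact hsym i j hi' hj'
  · obtain rfl : j = c := Fin.ext (hj'.trans hc.symm)
    exact key i hi'
  · obtain rfl : i = c := Fin.ext (hi'.trans hc.symm)
    rw [Equiv.swap_comm]
    exact key j hj'
  · obtain rfl : i = j := Fin.ext (hi'.trans hj'.symm)
    rw [Equiv.swap_self]
    rfl

/-- **Lemma 20 (a weaker symmetry property suffices).**
If `α : G^k → 𝔽₂` (`k ≥ 4`) is multilinear and symmetric in its first three variables,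
then `φ = α + α∘(3 4)` satisfies `φ + φ∘(1 3) + φ∘(1 4) = 0`; and if moreover
`φ = φ∘(1 4)`, then `α` is symmetric in its first four variables. -/
theorem statement14 (n k : ℕ) (hk : 4 ≤ k)
    (α : (Fin k → (Fin n → ZMod 2)) → ZMod 2) (hα : IsMultilinear k α)
    (hsym : SymmetricInFirst k 3 α) :
    ((α + permForm k (Equiv.swap ⟨2, by omega⟩ ⟨3, by omega⟩) α) +
      permForm k (Equiv.swap ⟨0, by omega⟩ ⟨2, by omega⟩)
        (α + permForm k (Equiv.swap ⟨2, by omega⟩ ⟨3, by omega⟩) α) +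
      permForm k (Equiv.swap ⟨0, by omega⟩ ⟨3, by omega⟩)
        (α + permForm k (Equiv.swap ⟨2, by omega⟩ ⟨3, by omega⟩) α) = 0) ∧
    (permForm k (Equiv.swap ⟨0, by omega⟩ ⟨3, by omega⟩)
        (α + permForm k (Equiv.swap ⟨2, by omega⟩ ⟨3, by omega⟩) α) =
      α + permForm k (Equiv.swap ⟨2, by omega⟩ ⟨3, by omega⟩) α →
      SymmetricInFirst k 4 α) := by
  have h02 := hsym ⟨0, by omega⟩ ⟨2, by omega⟩ (by simp) (by simp)
  have hA := permForm_swap_permForm_swap (c := ⟨3, by omega⟩) h02 (by simp) (by simp)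
  have hB := permForm_swap_permForm_swap_of_invariant (c := ⟨3, by omega⟩) h02
    (by simp) (by simp)
  simp only [permForm_add, hA, hB, h02]
  refine ⟨?_, fun h => hsym.succ (by simp) rfl (add_right_cancel h)⟩
  funext x
  simp only [Pi.add_apply, Pi.zero_apply]
  linear_combination (α x + permForm k (Equiv.swap ⟨2, by omega⟩ ⟨3, by omega⟩) α x +
    permForm k (Equiv.swap ⟨0, by omega⟩ ⟨3, by omega⟩) α x) * CharTwo.two_eq_zero (R := ZMod 2)
end
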